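/- Let r be a nonnegative integer, A ⊆ ℝ^m a definable set, and f: A × (0, ∞) → ℝ a definable function. Then there exists an odd, strictly increasing, definable C^r bijection φ: ℝ → ℝ which is r-flat at 0 (φ(0) = 0 and all derivatives of φ up to order r vanish at 0) such that for every x ∈ A, φ(t)·f(x,t) → 0 as t → 0⁺. -/

import Mathlib

open FirstOrder Set Topology

namespace Paper

variable (L : FirstOrder.Language) [L.Structure ℝ]

/-- A subset of `ℝⁿ` is definable in the structure (with parameters from `ℝ`). -/
def Def (n : ℕ) (s : Set (Fin n → ℝ)) : Prop :=
  Set.Definable (Set.univ : Set ℝ) L s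

/-- A subset of `ℝ` is definable. -/
def Def1 (s : Set ℝ) : Prop := Def L 1 {x | x 0 ∈ s}

/-- The structure expands the ordered field `(ℝ, <, +, ·, 0, 1)`:
the order and the field operations (and the constants) are definable. -/
def ExpandsOrderedField : Prop :=
  Def L 2 {x | x 0 < x 1} ∧ Def L 3 {x | x 0 + x 1 = x 2} ∧
  Def L 3 {x | x 0 * x 1 = x 2} ∧ Def L 1 {x | x 0 = 0} ∧ Def L 1 {x | x 0 = 1}

/-- Local o-minimality: every definable subset of `ℝ` is, near each point, a finite
union of points and open intervals. -/
def LocallyOMinimal : Prop :=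
  ∀ X : Set ℝ, Def1 L X → ∀ a : ℝ,
    ∃ b c : ℝ, b < a ∧ a < c ∧
      ∃ (P : Finset ℝ) (J : Finset (ℝ × ℝ)),
        X ∩ Set.Ioo b c = ↑P ∪ ⋃ p ∈ J, Set.Ioo p.1 p.2

/-- First component of a point of `ℝ^(m+n) = ℝ^m × ℝ^n`. -/
def fstFun {m n : ℕ} (z : Fin (m + n) → ℝ) : Fin m → ℝ := fun i => z (Fin.castAdd n i)

/-- Second component of a point of `ℝ^(m+n) = ℝ^m × ℝ^n`. -/
def sndFun {m n : ℕ} (z : Fin (m + n) → ℝ) : Fin n → ℝ := fun j => z (Fin.natAdd m j)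

/-- The map `f : X → ℝⁿ`, `X ⊆ ℝ^m`, is definable (its graph over `X` is definable). -/
def DefMapOn (m n : ℕ) (X : Set (Fin m → ℝ)) (f : (Fin m → ℝ) → (Fin n → ℝ)) : Prop :=
  Def L (m + n) {z | fstFun z ∈ X ∧ sndFun z = f (fstFun z)}

/-- The function `f : X → ℝ`, `X ⊆ ℝ^m`, is definable. -/
def DefFunOn (m : ℕ) (X : Set (Fin m → ℝ)) (f : (Fin m → ℝ) → ℝ) : Prop :=
  DefMapOn L m 1 X fun x _ => f x

/-- `f` is of class `C^r` on `X` in the sense that near every point of `X` it agrees on `X`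
with a `C^r` map defined on an open neighborhood in the ambient space. -/
def CrMapOn (r m n : ℕ) (X : Set (Fin m → ℝ)) (f : (Fin m → ℝ) → (Fin n → ℝ)) : Prop :=
  ∀ a ∈ X, ∃ (W : Set (Fin m → ℝ)) (g : (Fin m → ℝ) → (Fin n → ℝ)),
    a ∈ W ∧ IsOpen W ∧ ContDiffOn ℝ r g W ∧ Set.EqOn f g (X ∩ W)

/-- Real-valued version of `CrMapOn`. -/
def CrFunOn (r m : ℕ) (X : Set (Fin m → ℝ)) (f : (Fin m → ℝ) → ℝ) : Prop :=
  ∀ a ∈ X, ∃ (W : Set (Fin m → ℝ)) (g : (Fin m → ℝ) → ℝ),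
    a ∈ W ∧ IsOpen W ∧ ContDiffOn ℝ r g W ∧ Set.EqOn f g (X ∩ W)

/-- A definable `C^r` map `X → ℝⁿ`. -/
def DefCrMapOn (r m n : ℕ) (X : Set (Fin m → ℝ)) (f : (Fin m → ℝ) → (Fin n → ℝ)) : Prop :=
  DefMapOn L m n X f ∧ CrMapOn r m n X f

/-- A definable `C^r` function `X → ℝ`. -/
def DefCrFunOn (r m : ℕ) (X : Set (Fin m → ℝ)) (f : (Fin m → ℝ) → ℝ) : Prop :=
  DefFunOn L m X f ∧ CrFunOn r m X f

/-- A definable `C^r` submanifold of `ℝⁿ` of dimension `d`: around every point there is a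
definable `C^r` chart of `ℝⁿ` straightening `M` to the first `d` coordinates. -/
def IsDefCrSubmanifold (r n d : ℕ) (M : Set (Fin n → ℝ)) : Prop :=
  Def L n M ∧
  ∀ a ∈ M, ∃ (U V : Set (Fin n → ℝ)) (φ ψ : (Fin n → ℝ) → (Fin n → ℝ)),
    a ∈ U ∧ IsOpen U ∧ Def L n U ∧
    (0 : Fin n → ℝ) ∈ V ∧ IsOpen V ∧ Def L n V ∧
    DefMapOn L n n U φ ∧ DefMapOn L n n V ψ ∧
    ContDiffOn ℝ r φ U ∧ ContDiffOn ℝ r ψ V ∧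
    Set.BijOn φ U V ∧ Set.InvOn ψ φ U V ∧
    φ a = 0 ∧
    φ '' (M ∩ U) = {x ∈ V | ∀ i : Fin n, d ≤ (i : ℕ) → x i = 0}

/-- The Euclidean norm on `ℝⁿ`. -/
noncomputable def eunorm {n : ℕ} (x : Fin n → ℝ) : ℝ := Real.sqrt (∑ i, x i ^ 2)

/-- Projection of `ℝⁿ` onto the `d` coordinates selected by `σ`. -/
def coordProj {n : ℕ} (d : ℕ) (σ : Fin d → Fin n) (x : Fin n → ℝ) : Fin d → ℝ :=
  fun i => x (σ i)

/-- `X ⊆ ℝⁿ` has dimension `d`: `d` is the largest integer such that some coordinate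
projection of `X` onto `ℝ^d` has nonempty interior. -/
def HasDim {n : ℕ} (X : Set (Fin n → ℝ)) (d : ℕ) : Prop :=
  (∃ σ : Fin d → Fin n, Function.Injective σ ∧ (interior (coordProj d σ '' X)).Nonempty) ∧
  ∀ (e : ℕ) (σ : Fin e → Fin n), Function.Injective σ →
    (interior (coordProj e σ '' X)).Nonempty → e ≤ d

/-- A (bounded) open box in `ℝⁿ`. -/
def IsOpenBox {n : ℕ} (B : Set (Fin n → ℝ)) : Prop :=
  ∃ a b : Fin n → ℝ, (∀ i, a i < b i) ∧ B = Set.pi Set.univ fun i => Set.Ioo (a i) (b i)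


/-- Coordinates on `ℝ^(m+1+1) = ℝ^m × ℝ × ℝ`, used to encode graphs of functions of
`(x, t) ∈ ℝ^m × ℝ`. -/
def x2 {m : ℕ} (z : Fin (m + 1 + 1) → ℝ) : Fin m → ℝ := fun i => z ((i.castAdd 1).castAdd 1)

def t2 {m : ℕ} (z : Fin (m + 1 + 1) → ℝ) : ℝ := z ((Fin.last m).castAdd 1)

def v2 {m : ℕ} (z : Fin (m + 1 + 1) → ℝ) : ℝ := z (Fin.last (m + 1))

section Calculus

variable {L} {α β : Type} {P Q : (α → ℝ) → Prop} {S T : (α → ℝ) → ℝ}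

variable (L) in
/-- A predicate on real tuples is definable (with real parameters). -/
def DPred (P : (α → ℝ) → Prop) : Prop :=
  (Set.univ : Set ℝ).Definable L {v | P v}

variable (L) in
/-- A real function of real tuples is definable (with real parameters). -/
def DFun (T : (α → ℝ) → ℝ) : Prop :=
  (Set.univ : Set ℝ).DefinableFun L T

theorem DPred.and (hP : DPred L P) (hQ : DPred L Q) : DPred L fun v => P v ∧ Q v :=
  Set.Definable.inter hP hQ

theorem DPred.or (hP : DPred L P) (hQ : DPred L Q) : DPred L fun v => P v ∨ Q v :=
  Set.Definable.union hP hQ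

theorem DPred.not (hP : DPred L P) : DPred L fun v => ¬ P v :=
  Set.Definable.compl hP

theorem DPred.imp (hP : DPred L P) (hQ : DPred L Q) : DPred L fun v => P v → Q v := by
  simpa only [imp_iff_not_or] using hP.not.or hQ

theorem DPred.ex [Finite α] {R : (α → ℝ) → ℝ → Prop}
    (h : DPred L fun w : Option α → ℝ => R (fun a => w (some a)) (w none)) :
    DPred L fun v => ∃ y, R v y := by
  have := Set.Definable.image_comp h (some : α → Option α)
  unfold DPred
  convert this using 1
  ext v
  constructor
  · rintro ⟨y, hy⟩
    exact ⟨fun o => o.elim y v, hy, rfl⟩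
  · rintro ⟨w, hw, rfl⟩
    exact ⟨w none, hw⟩

theorem DPred.all [Finite α] {R : (α → ℝ) → ℝ → Prop}
    (h : DPred L fun w : Option α → ℝ => R (fun a => w (some a)) (w none)) :
    DPred L fun v => ∀ y, R v y := by
  simpa using (DPred.ex (R := fun v y => ¬ R v y) h.not).not

theorem DPred.comp [Finite β] {R : (β → ℝ) → Prop} (hR : DPred L R) {X : (α → ℝ) → β → ℝ}
    (hX : ∀ b, DFun L fun v => X v b) : DPred L fun v => R (X v) :=
  Set.Definable.preimage_map (F := X) hX hR

theorem DFun.comp [Finite β] {U : (β → ℝ) → ℝ} (hU : DFun L U) {X : (α → ℝ) → β → ℝ}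
    (hX : ∀ b, DFun L fun v => X v b) : DFun L fun v => U (X v) :=
  Set.DefinableFun.comp (g := X) hX hU

theorem DFun.comp_one {u : ℝ → ℝ} (hu : DFun L fun x : Fin 1 → ℝ => u (x 0))
    (hT : DFun L T) : DFun L fun v => u (T v) :=
  hu.comp (X := fun v _ => T v) fun _ => hT

theorem DFun.var (a : α) : DFun L fun v : α → ℝ => v a := Set.DefinableFun.proj L

theorem DFun.const (c : ℝ) : DFun L fun _ : α → ℝ => c :=
  L.definableFun_const α (Set.mem_univ c)

theorem DFun.of_graph (h : DPred L fun w : Option α → ℝ => T (fun a => w (some a)) = w none) :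
    DFun L T := h

theorem DPred.eq (hS : DFun L S) (hT : DFun L T) : DPred L fun v => S v = T v :=
  Set.DefinableFun.ofPred_eq hS hT

theorem DFun.ite [DecidablePred P] (hP : DPred L P) (hS : DFun L S) (hT : DFun L T) :
    DFun L fun v => if P v then S v else T v :=
  Set.DefinableFun.ite hP hS hT

variable (hfield : ExpandsOrderedField L)
include hfield

theorem DPred.lt (hS : DFun L S) (hT : DFun L T) : DPred L fun v => S v < T v := by
  refine DPred.comp (R := fun x : Fin 2 → ℝ => x 0 < x 1) hfield.1 (X := fun v => ![S v, T v]) ?_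
  simp [Fin.forall_fin_two, hS, hT]

theorem DPred.le (hS : DFun L S) (hT : DFun L T) : DPred L fun v => S v ≤ T v := by
  simpa only [not_lt] using (DPred.lt hfield hT hS).not

theorem DFun.add (hS : DFun L S) (hT : DFun L T) : DFun L fun v => S v + T v := by
  have : DFun L fun x : Fin 2 → ℝ => x 0 + x 1 := by
    refine DPred.comp (R := fun x : Fin 3 → ℝ => x 0 + x 1 = x 2) hfield.2.1
      (X := fun w => ![w (some 0), w (some 1), w none]) ?_
    simp [Fin.forall_fin_succ, DFun.var]
  refine this.comp (X := fun v => ![S v, T v]) ?_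
  simp [Fin.forall_fin_two, hS, hT]

theorem DFun.mul (hS : DFun L S) (hT : DFun L T) : DFun L fun v => S v * T v := by
  have : DFun L fun x : Fin 2 → ℝ => x 0 * x 1 := by
    refine DPred.comp (R := fun x : Fin 3 → ℝ => x 0 * x 1 = x 2) hfield.2.2.1
      (X := fun w => ![w (some 0), w (some 1), w none]) ?_
    simp [Fin.forall_fin_succ, DFun.var]
  refine this.comp (X := fun v => ![S v, T v]) ?_
  simp [Fin.forall_fin_two, hS, hT]

theorem DFun.neg (hT : DFun L T) : DFun L fun v => -T v := by
  simpa using DFun.mul hfield (DFun.const (-1)) hT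

theorem DFun.sub (hS : DFun L S) (hT : DFun L T) : DFun L fun v => S v - T v := by
  simpa [sub_eq_add_neg] using DFun.add hfield hS (DFun.neg hfield hT)

theorem DFun.pow (hT : DFun L T) (n : ℕ) : DFun L fun v => T v ^ n := by
  induction n with
  | zero => simpa using DFun.const 1
  | succ n ih => simpa [pow_succ] using DFun.mul hfield ih hT

theorem DFun.inv (hT : DFun L T) : DFun L fun v => (T v)⁻¹ := by
  have : DFun L fun x : Fin 1 → ℝ => (x 0)⁻¹ := by
    refine DFun.of_graph ?_
    have h : DPred L fun w : Option (Fin 1) → ℝ =>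
        (w (some 0) = 0 ∧ w none = 0) ∨ w (some 0) * w none = 1 :=
      ((DPred.eq (DFun.var _) (DFun.const 0)).and (DPred.eq (DFun.var _) (DFun.const 0))).or
        (DPred.eq (DFun.mul hfield (DFun.var _) (DFun.var _)) (DFun.const 1))
    convert h using 2 with w
    by_cases h0 : w (some 0) = 0
    · simp [h0, eq_comm]
    · simp [h0, mul_eq_one_iff_inv_eq₀]
  exact DFun.comp_one (u := fun x => x⁻¹) this hT

theorem DFun.div (hS : DFun L S) (hT : DFun L T) : DFun L fun v => S v / T v := by
  simpa [div_eq_mul_inv] using DFun.mul hfield hS (DFun.inv hfield hT)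

theorem DFun.max (hS : DFun L S) (hT : DFun L T) : DFun L fun v => max (S v) (T v) := by
  classical
  simpa only [max_def] using DFun.ite (DPred.le hfield hS hT) hT hS

theorem DFun.abs (hT : DFun L T) : DFun L fun v => |T v| :=
  DFun.max hfield hT (DFun.neg hfield hT)

theorem DPred.mem_lowerBounds [Finite α] {R : (α → ℝ) → ℝ → Prop}
    (hR : DPred L fun w : Option α → ℝ => R (fun a => w (some a)) (w none)) (hT : DFun L T) :
    DPred L fun v => T v ∈ lowerBounds {y | R v y} := by
  have : DPred L fun v => ∀ y, R v y → T v ≤ y :=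
    DPred.all (hR.imp (DPred.le hfield (hT.comp fun _ => DFun.var _) (DFun.var _)))
  exact this

theorem DFun.csInf [Finite α] {R : (α → ℝ) → ℝ → Prop}
    (hR : DPred L fun w : Option α → ℝ => R (fun a => w (some a)) (w none)) :
    DFun L fun v => sInf {y | R v y} := by
  refine DFun.of_graph ?_
  have hR' : DPred L fun w : Option (Option α) → ℝ => R (fun a => w (some (some a))) (w none) :=
    DPred.comp (R := fun w : Option α → ℝ => R (fun a => w (some a)) (w none)) hR
      (X := fun w o => o.elim (w none) fun a => w (some (some a)))
      (by rintro (_ | a) <;> exact DFun.var _)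
  have hne : DPred L fun w : Option α → ℝ => ∃ y, R (fun a => w (some a)) y := DPred.ex hR'
  have hbd : DPred L fun w : Option α → ℝ =>
      ∃ z, z ∈ lowerBounds {y | R (fun a => w (some a)) y} := by
    refine DPred.ex (DPred.mem_lowerBounds hfield ?_ (DFun.var _))
    exact DPred.comp (R := fun w : Option α → ℝ => R (fun a => w (some a)) (w none)) hR
      (X := fun w o => o.elim (w none) fun a => w (some (some (some a))))
      (by rintro (_ | a) <;> exact DFun.var _)
  have hglb : DPred L fun w : Option α → ℝ =>
      w none ∈ lowerBounds {y | R (fun a => w (some a)) y} ∧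
        ∀ z, z ∈ lowerBounds {y | R (fun a => w (some a)) y} → z ≤ w none := by
    refine (DPred.mem_lowerBounds hfield hR' (DFun.var _)).and (DPred.all (DPred.imp
      (DPred.mem_lowerBounds hfield ?_ (DFun.var _)) (DPred.le hfield (DFun.var _) (DFun.var _))))
    exact DPred.comp (R := fun w : Option α → ℝ => R (fun a => w (some a)) (w none)) hR
      (X := fun w o => o.elim (w none) fun a => w (some (some (some a))))
      (by rintro (_ | a) <;> exact DFun.var _)
  have key := ((hne.and hbd).and hglb).or
    ((hne.and hbd).not.and (DPred.eq (DFun.var (none : Option α)) (DFun.const 0)))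
  convert key using 2 with w
  set s := {y | R (fun a => w (some a)) y}
  change sInf s = w none ↔ ((s.Nonempty ∧ BddBelow s) ∧ IsGLB s (w none)) ∨
    ¬ (s.Nonempty ∧ BddBelow s) ∧ w none = 0
  by_cases h : s.Nonempty ∧ BddBelow s
  · have := isGLB_csInf h.1 h.2
    simp only [h, not_true, false_and, or_false, and_self, true_and]
    exact ⟨fun e => e ▸ this, fun e => this.unique e⟩
  · have h0 : sInf s = 0 := by
      rcases not_and_or.1 h with h | h
      · rw [Set.not_nonempty_iff_eq_empty.1 h, Real.sInf_empty]
      · exact Real.sInf_of_not_bddBelow h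
    simp [h, h0, eq_comm]

theorem DFun.csSup [Finite α] {R : (α → ℝ) → ℝ → Prop}
    (hR : DPred L fun w : Option α → ℝ => R (fun a => w (some a)) (w none)) :
    DFun L fun v => sSup {y | R v y} := by
  have h : DFun L fun v => sInf {y | R v (-y)} := by
    refine DFun.csInf hfield (R := fun v y => R v (-y)) ?_
    exact DPred.comp (R := fun w : Option α → ℝ => R (fun a => w (some a)) (w none)) hR
      (X := fun w o => o.elim (-w none) fun a => w (some a))
      (by
        rintro (_ | a)
        · exact DFun.neg hfield (DFun.var _)
        · exact DFun.var _)
  convert DFun.neg hfield h using 2 with v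
  rw [show {y | R v (-y)} = -{y | R v y} from rfl, Real.sInf_neg, neg_neg]

end Calculus

section Germ

variable {L} {α : Type} {p : ℝ → Prop}

open Filter in
theorem LocallyOMinimal.eventually_or_eventually_not (hlom : LocallyOMinimal L)
    (hp : DPred L fun x : Fin 1 → ℝ => p (x 0)) {a : ℝ} {l : Filter ℝ} (hla : l ≤ 𝓝 a)
    (hlt : ∀ c, (∀ᶠ t in l, t < c) ∨ ∀ᶠ t in l, ¬ t < c)
    (hgt : ∀ c, (∀ᶠ t in l, c < t) ∨ ∀ᶠ t in l, ¬ c < t) :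
    (∀ᶠ t in l, p t) ∨ ∀ᶠ t in l, ¬ p t := by
  obtain ⟨b, c, hb, hc, P, J, h⟩ := hlom {t | p t} hp a
  have hIoo : ∀ u v : ℝ, (∀ᶠ t in l, t ∈ Ioo u v) ∨ ∀ᶠ t in l, t ∉ Ioo u v := by
    intro u v
    rcases hgt u with h1 | h1
    · rcases hlt v with h2 | h2
      · exact Or.inl (h1.and h2)
      · exact Or.inr (h2.mono fun t ht h => ht h.2)
    · exact Or.inr (h1.mono fun t ht h => ht h.1)
  have hne : ∀ u : ℝ, (∀ᶠ t in l, t = u) ∨ ∀ᶠ t in l, t ≠ u := by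
    intro u
    rcases hgt u with h1 | h1
    · exact Or.inr (h1.mono fun t ht => ht.ne')
    · rcases hlt u with h2 | h2
      · exact Or.inr (h2.mono fun t ht => ht.ne)
      · left
        filter_upwards [h1, h2] with t ht ht'
        exact le_antisymm (not_lt.1 ht) (not_lt.1 ht')
  have hP : (∀ᶠ t in l, t ∈ (P : Set ℝ)) ∨ ∀ᶠ t in l, t ∉ (P : Set ℝ) := by
    by_cases h : ∃ u ∈ P, ∀ᶠ t in l, t = u
    · obtain ⟨u, hu, h⟩ := h
      exact Or.inl (h.mono fun t ht => ht ▸ hu)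
    · push Not at h
      right
      have : ∀ u ∈ P, ∀ᶠ t in l, t ≠ u := fun u hu =>
        (hne u).resolve_left fun hc => absurd hc (by simpa using h u hu)
      filter_upwards [(Filter.eventually_all_finset P).2 this] with t ht hm
      exact ht t hm rfl
  have hJ : (∀ᶠ t in l, t ∈ ⋃ q ∈ J, Ioo q.1 q.2) ∨ ∀ᶠ t in l, t ∉ ⋃ q ∈ J, Ioo q.1 q.2 := by
    by_cases h : ∃ q ∈ J, ∀ᶠ t in l, t ∈ Ioo q.1 q.2
    · obtain ⟨q, hq, h⟩ := h
      exact Or.inl (h.mono fun t ht => mem_biUnion hq ht)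
    · right
      have : ∀ q ∈ J, ∀ᶠ t in l, t ∉ Ioo q.1 q.2 := fun q hq =>
        (hIoo q.1 q.2).resolve_left fun hc => h ⟨q, hq, hc⟩
      filter_upwards [(Filter.eventually_all_finset J).2 this] with t ht hm
      obtain ⟨q, hq, hm⟩ := mem_iUnion₂.1 hm
      exact ht q hq hm
  have hmem : ∀ᶠ t in l, t ∈ Ioo b c := hla (Ioo_mem_nhds hb hc)
  have hiff : ∀ᶠ t in l, (p t ↔ t ∈ (P : Set ℝ) ∨ t ∈ ⋃ q ∈ J, Ioo q.1 q.2) := by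
    filter_upwards [hmem] with t ht
    have := Set.ext_iff.1 h t
    rw [mem_union] at this
    rw [← this]
    exact ⟨fun h => ⟨h, ht⟩, fun h => h.1⟩
  rcases hP with hP | hP
  · left
    filter_upwards [hiff, hP] with t h1 h2 using h1.2 (Or.inl h2)
  · rcases hJ with hJ | hJ
    · left
      filter_upwards [hiff, hJ] with t h1 h2 using h1.2 (Or.inr h2)
    · right
      filter_upwards [hiff, hP, hJ] with t h1 h2 h3 h4
      exact (h1.1 h4).elim h2 h3

theorem LocallyOMinimal.right (hlom : LocallyOMinimal L)
    (hp : DPred L fun x : Fin 1 → ℝ => p (x 0)) (a : ℝ) :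
    (∀ᶠ t in 𝓝[>] a, p t) ∨ ∀ᶠ t in 𝓝[>] a, ¬ p t := by
  refine hlom.eventually_or_eventually_not hp nhdsWithin_le_nhds (fun c => ?_) fun c => ?_
  · rcases lt_or_ge a c with h | h
    · exact Or.inl (nhdsWithin_le_nhds (Iio_mem_nhds h))
    · exact Or.inr (Filter.mem_of_superset self_mem_nhdsWithin fun t (ht : a < t) => (h.trans_lt ht).not_gt)
  · rcases lt_or_ge a c with h | h
    · exact Or.inr (nhdsWithin_le_nhds (Filter.mem_of_superset (Iio_mem_nhds h) fun t ht => not_lt.2 (le_of_lt ht)))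
    · exact Or.inl (Filter.mem_of_superset self_mem_nhdsWithin fun t (ht : a < t) => h.trans_lt ht)

theorem LocallyOMinimal.left (hlom : LocallyOMinimal L)
    (hp : DPred L fun x : Fin 1 → ℝ => p (x 0)) (a : ℝ) :
    (∀ᶠ t in 𝓝[<] a, p t) ∨ ∀ᶠ t in 𝓝[<] a, ¬ p t := by
  refine hlom.eventually_or_eventually_not hp nhdsWithin_le_nhds (fun c => ?_) fun c => ?_
  · rcases lt_or_ge c a with h | h
    · exact Or.inr (nhdsWithin_le_nhds (Filter.mem_of_superset (Ioi_mem_nhds h) fun t ht => not_lt.2 (le_of_lt ht)))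
    · exact Or.inl (Filter.mem_of_superset self_mem_nhdsWithin fun t (ht : t < a) => ht.trans_le h)
  · rcases lt_or_ge c a with h | h
    · exact Or.inl (nhdsWithin_le_nhds (Ioi_mem_nhds h))
    · exact Or.inr (Filter.mem_of_superset self_mem_nhdsWithin fun t (ht : t < a) => (ht.trans_le h).not_gt)

/-- A definable set without interior is locally finite. -/
theorem LocallyOMinimal.exists_Ioo_or_finite (hlom : LocallyOMinimal L)
    (hp : DPred L fun x : Fin 1 → ℝ => p (x 0)) :
    (∃ a b, a < b ∧ ∀ t ∈ Ioo a b, p t) ∨ ∀ a b, ({t | p t} ∩ Icc a b).Finite := by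
  by_contra! h
  obtain ⟨h, a, b, hinf⟩ := h
  obtain ⟨x, -, hx⟩ := Set.Infinite.exists_accPt_of_subset_isCompact hinf isCompact_Icc
    inter_subset_right
  rw [accPt_iff_frequently_nhdsNE, ← nhdsLT_sup_nhdsGT, Filter.frequently_sup] at hx
  rcases hx with hx | hx
  · rcases hlom.left hp x with h1 | h1
    · obtain ⟨u, hu, hu'⟩ := (mem_nhdsLT_iff_exists_Ioo_subset).1 h1
      obtain ⟨t, ht, ht'⟩ := h u x hu
      exact ht' (hu' ht)
    · exact hx (h1.mono fun t ht h => ht h.1)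
  · rcases hlom.right hp x with h1 | h1
    · obtain ⟨u, hu, hu'⟩ := (mem_nhdsGT_iff_exists_Ioo_subset).1 h1
      obtain ⟨t, ht, ht'⟩ := h x u hu
      exact ht' (hu' ht)
    · exact hx (h1.mono fun t ht h => ht h.1)

/-- If countably many definable sets cover an interval, then one of them has interior. -/
theorem LocallyOMinimal.exists_Ioo_of_countable_cover (hlom : LocallyOMinimal L) {ι : Type*}
    [Countable ι] {q : ι → ℝ → Prop} (hq : ∀ i, DPred L fun x : Fin 1 → ℝ => q i (x 0)) {a b : ℝ}
    (hab : a < b) (hcov : ∀ t ∈ Ioo a b, ∃ i, q i t) :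
    ∃ i c d, c < d ∧ ∀ t ∈ Ioo c d, q i t := by
  by_contra! h
  have hfin : ∀ i, ({t | q i t} ∩ Icc a b).Finite := fun i =>
    ((hlom.exists_Ioo_or_finite (hq i)).resolve_left fun ⟨c, d, hcd, hall⟩ => by
      obtain ⟨t, ht, hn⟩ := h i c d hcd
      exact hn (hall t ht)) a b
  have hc : (Ioo a b).Countable := by
    refine (countable_iUnion fun i => (hfin i).countable).mono fun t ht => ?_
    obtain ⟨i, hi⟩ := hcov t ht
    exact mem_iUnion.2 ⟨i, hi, Ioo_subset_Icc_self ht⟩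
  have := Cardinal.mk_Ioo_real hab
  have h2 := Cardinal.le_aleph0_iff_set_countable.2 hc
  rw [this] at h2
  exact absurd h2 (not_le.2 Cardinal.aleph0_lt_continuum)

theorem DPred.eventually_nhdsGT (hfield : ExpandsOrderedField L) [Finite α]
    {R : (α → ℝ) → ℝ → Prop} {S : (α → ℝ) → ℝ}
    (hR : DPred L fun w : Option α → ℝ => R (fun a => w (some a)) (w none)) (hS : DFun L S) :
    DPred L fun v => ∀ᶠ t in 𝓝[>] S v, R v t := by
  have h : DPred L fun v => ∃ d, S v < d ∧ ∀ t, S v < t ∧ t < d → R v t := by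
    refine DPred.ex ((DPred.lt hfield (hS.comp fun _ => DFun.var _) (DFun.var _)).and
      (DPred.all (DPred.imp (DPred.and (DPred.lt hfield (hS.comp fun _ => DFun.var _) (DFun.var _))
        (DPred.lt hfield (DFun.var _) (DFun.var _))) ?_)))
    exact DPred.comp (R := fun w : Option α → ℝ => R (fun a => w (some a)) (w none)) hR
      (X := fun w o => o.elim (w none) fun a => w (some (some a)))
      (by rintro (_ | a) <;> exact DFun.var _)
  convert h using 2 with v
  exact mem_nhdsGT_iff_exists_Ioo_subset

theorem DPred.eventually_nhdsLT (hfield : ExpandsOrderedField L) [Finite α]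
    {R : (α → ℝ) → ℝ → Prop} {S : (α → ℝ) → ℝ}
    (hR : DPred L fun w : Option α → ℝ => R (fun a => w (some a)) (w none)) (hS : DFun L S) :
    DPred L fun v => ∀ᶠ t in 𝓝[<] S v, R v t := by
  have h : DPred L fun v => ∃ d, d < S v ∧ ∀ t, d < t ∧ t < S v → R v t := by
    refine DPred.ex ((DPred.lt hfield (DFun.var _) (hS.comp fun _ => DFun.var _)).and
      (DPred.all (DPred.imp (DPred.and (DPred.lt hfield (DFun.var _) (DFun.var _))
        (DPred.lt hfield (DFun.var _) (hS.comp fun _ => DFun.var _))) ?_)))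
    exact DPred.comp (R := fun w : Option α → ℝ => R (fun a => w (some a)) (w none)) hR
      (X := fun w o => o.elim (w none) fun a => w (some (some a)))
      (by rintro (_ | a) <;> exact DFun.var _)
  convert h using 2 with v
  exact mem_nhdsLT_iff_exists_Ioo_subset

end Germ

section Domination

variable {L}

/-- The pigeonhole step: on a fixed bounded interval, a real function is below some bound at some
point of every subinterval of a given length. -/
theorem exists_bound_on_every_subinterval (h : ℝ → ℝ) {t : ℝ} (ht : 0 < t) :
    ∃ M, 0 ≤ M ∧ ∀ a, -1 ≤ t * a → t * (a + t) ≤ 1 → ∃ y, a ≤ y ∧ y ≤ a + t ∧ h y ≤ M := by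
  by_contra! hcon
  choose a ha1 ha2 ha using fun n : ℕ => hcon n n.cast_nonneg
  have hK : ∀ n, a n ∈ Icc (-1 / t) (1 / t) := fun n => by
    constructor
    · rw [div_le_iff₀ ht]; linarith [ha1 n]
    · rw [le_div_iff₀ ht]; nlinarith [ha2 n]
  obtain ⟨b, -, φ, hφ, hb⟩ := isCompact_Icc.tendsto_subseq hK
  have h1 : ∀ᶠ n in Filter.atTop, a (φ n) < b + t / 2 :=
    hb.eventually (Iio_mem_nhds (by linarith))
  have h2 : ∀ᶠ n in Filter.atTop, b - t / 2 < a (φ n) :=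
    hb.eventually (Ioi_mem_nhds (by linarith))
  have h3 : ∀ᶠ n : ℕ in Filter.atTop, h (b + t / 2) < n :=
    tendsto_natCast_atTop_atTop.eventually_gt_atTop _
  obtain ⟨n, h1, h2, h3⟩ := (h1.and (h2.and h3)).exists
  have h4 := ha (φ n) (b + t / 2) h1.le (by linarith)
  have h5 : (n : ℝ) ≤ φ n := by exact_mod_cast hφ.id_le n
  linarith

theorem exists_dominating_step (hfield : ExpandsOrderedField L) (hlom : LocallyOMinimal L)
    {α : Type} [Finite α] {F : ℝ → ℝ → (α → ℝ) → ℝ}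
    (hF : DFun L fun w : Option (Option α) → ℝ =>
      F (w (some none)) (w none) fun a => w (some (some a))) :
    ∃ G : ℝ → (α → ℝ) → ℝ, DFun L (fun w : Option α → ℝ => G (w none) fun a => w (some a)) ∧
      ∀ y x, ∀ᶠ t in 𝓝[>] 0, F t y x ≤ G t x := by
  have hF' : ∀ {γ : Type} {T Y : (γ → ℝ) → ℝ} {X : (γ → ℝ) → α → ℝ}, DFun L T → DFun L Y →
      (∀ a, DFun L fun v => X v a) → DFun L fun v => F (T v) (Y v) (X v) := by
    intro γ T Y X hT hY hX
    refine hF.comp (X := fun v o => o.elim (Y v) fun o' => o'.elim (T v) (X v)) ?_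
    rintro (_ | _ | a)
    exacts [hY, hT, hX a]
  let G₁ : ℝ → (α → ℝ) → ℝ := fun t x => sInf {M | 0 ≤ M ∧ ∀ a, -1 ≤ t * a → t * (a + t) ≤ 1 →
    ∃ y, a ≤ y ∧ y ≤ a + t ∧ F t y x ≤ M} + 1
  have hG₁ : DFun L fun w : Option α → ℝ => G₁ (w none) fun a => w (some a) := by
    refine DFun.add hfield (DFun.csInf hfield ?_) (DFun.const 1)
    refine (DPred.le hfield (DFun.const 0) (DFun.var _)).and (DPred.all (DPred.imp
      (DPred.le hfield (DFun.const _) (DFun.mul hfield (DFun.var _) (DFun.var _))) (DPred.imp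
      (DPred.le hfield (DFun.mul hfield (DFun.var _) (DFun.add hfield (DFun.var _) (DFun.var _)))
        (DFun.const 1)) (DPred.ex ?_))))
    refine (DPred.le hfield (DFun.var _) (DFun.var _)).and ((DPred.le hfield (DFun.var _)
      (DFun.add hfield (DFun.var _) (DFun.var _))).and (DPred.le hfield ?_ (DFun.var _)))
    exact hF' (DFun.var _) (DFun.var _) fun _ => DFun.var _
  have hG₁' : ∀ {γ : Type} {T : (γ → ℝ) → ℝ} {X : (γ → ℝ) → α → ℝ}, DFun L T →
      (∀ a, DFun L fun v => X v a) → DFun L fun v => G₁ (T v) (X v) := by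
    intro γ T X hT hX
    refine hG₁.comp (X := fun v o => o.elim (T v) (X v)) ?_
    rintro (_ | a)
    exacts [hT, hX a]
  have hG₁_spec : ∀ t x, 0 < t → ∀ a, -1 ≤ t * a → t * (a + t) ≤ 1 →
      ∃ y, a ≤ y ∧ y ≤ a + t ∧ F t y x ≤ G₁ t x := by
    intro t x ht a ha1 ha2
    obtain ⟨M, hM, hlt⟩ := Real.lt_sInf_add_pos
      (exists_bound_on_every_subinterval (fun y => F t y x) ht) one_pos
    obtain ⟨y, h1, h2, h3⟩ := hM.2 a ha1 ha2
    exact ⟨y, h1, h2, h3.trans hlt.le⟩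
  have hfin : ∀ x a b, ({y | ∀ᶠ t in 𝓝[>] 0, G₁ t x < F t y x} ∩ Icc a b).Finite := by
    intro x
    have hdef : DPred L fun v : Fin 1 → ℝ => ∀ᶠ t in 𝓝[>] 0, G₁ t x < F t (v 0) x :=
      DPred.eventually_nhdsGT hfield (S := fun _ => 0) (R := fun v t => G₁ t x < F t (v 0) x)
        (DPred.lt hfield (hG₁' (DFun.var _) fun _ => DFun.const _)
          (hF' (DFun.var _) (DFun.var _) fun _ => DFun.const _)) (DFun.const 0)
    refine (hlom.exists_Ioo_or_finite (p := fun y => ∀ᶠ t in 𝓝[>] 0, G₁ t x < F t y x)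
      hdef).resolve_left ?_
    rintro ⟨a, b, hab, hall⟩
    obtain ⟨n, c, d, hcd, h⟩ := hlom.exists_Ioo_of_countable_cover
      (q := fun (n : ℕ) y => ∀ t : ℝ, 0 < t → t * (n + 1) < 1 → G₁ t x < F t y x)
      (fun n => DPred.all (DPred.imp (DPred.lt hfield (DFun.const 0) (DFun.var _))
        (DPred.imp (DPred.lt hfield (DFun.mul hfield (DFun.var _) (DFun.const _)) (DFun.const 1))
        (DPred.lt hfield (hG₁' (DFun.var _) fun _ => DFun.const _)
          (hF' (DFun.var _) (DFun.var _) fun _ => DFun.const _))))) hab (by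
        intro y hy
        obtain ⟨u, hu : 0 < u, hu'⟩ := mem_nhdsGT_iff_exists_Ioo_subset.1 (hall y hy)
        obtain ⟨n, hn⟩ := exists_nat_one_div_lt hu
        refine ⟨n, fun t ht htn => hu' ⟨ht, lt_trans ?_ hn⟩⟩
        rwa [lt_div_iff₀ (by positivity)])
    have hev : ∀ {g : ℝ → ℝ} {e : ℝ}, Continuous g → g 0 < e → ∀ᶠ t in 𝓝[>] (0 : ℝ), g t < e :=
      fun hg he => nhdsWithin_le_nhds (hg.continuousAt.eventually (Iio_mem_nhds he))
    have e1 := hev (g := fun t => t * (n + 1)) (e := 1) (by fun_prop) (by simp)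
    have e2 := hev (g := fun t => -(t * (c + t))) (e := 1) (by fun_prop) (by simp)
    have e3 := hev (g := fun t => t * (c + t + t)) (e := 1) (by fun_prop) (by simp)
    have e4 := hev (g := fun t => c + t + t) (e := d) (by fun_prop) (by simpa using hcd)
    obtain ⟨t, e1, e2, e3, e4, e5⟩ := (e1.and (e2.and (e3.and (e4.and self_mem_nhdsWithin)))).exists
    replace e5 : 0 < t := e5
    obtain ⟨y, h1, h2, h3⟩ := hG₁_spec t x e5 (c + t) (by linarith) e3.le
    exact absurd (h y ⟨by linarith, by linarith⟩ t e5 e1) (not_lt.2 h3)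
  let G₂ : ℝ → (α → ℝ) → ℝ := fun t x => sSup {v | ∃ y, (∀ᶠ t in 𝓝[>] 0, G₁ t x < F t y x) ∧
    |t * y| ≤ 1 ∧ v = F t y x}
  have hG₂ : DFun L fun w : Option α → ℝ => G₂ (w none) fun a => w (some a) := by
    refine DFun.csSup hfield (DPred.ex (DPred.and ?_ (DPred.and ?_ ?_)))
    · refine DPred.eventually_nhdsGT hfield (S := fun _ => 0)
        (R := fun (w : Option (Option (Option α)) → ℝ) t =>
          G₁ t (fun a => w (some (some (some a)))) <
            F t (w none) (fun a => w (some (some (some a))))) ?_ (DFun.const 0)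
      exact DPred.lt hfield (hG₁' (DFun.var _) fun _ => DFun.var _)
        (hF' (DFun.var _) (DFun.var _) fun _ => DFun.var _)
    · exact DPred.le hfield (DFun.abs hfield (DFun.mul hfield (DFun.var _) (DFun.var _)))
        (DFun.const 1)
    · exact DPred.eq (DFun.var _) (hF' (DFun.var _) (DFun.var _) fun _ => DFun.var _)
  refine ⟨fun t x => max (G₁ t x) (G₂ t x), DFun.max hfield hG₁ hG₂, fun y x => ?_⟩
  rcases hlom.right (p := fun t => G₁ t x < F t y x)
    (DPred.lt hfield (hG₁' (DFun.var _) fun _ => DFun.const _)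
      (hF' (DFun.var _) (DFun.const _) fun _ => DFun.const _)) 0 with hB | hB
  · have hsmall : ∀ᶠ t in 𝓝[>] (0 : ℝ), |t * y| < 1 :=
      nhdsWithin_le_nhds ((by fun_prop : Continuous fun t : ℝ => |t * y|).continuousAt.eventually
        (Iio_mem_nhds (by simp)))
    filter_upwards [hsmall, self_mem_nhdsWithin] with t ht (ht0 : 0 < t)
    refine le_max_of_le_right (le_csSup ?_ ⟨y, hB, ht.le, rfl⟩)
    refine (((hfin x (-1 / t) (1 / t)).image fun y => F t y x).subset ?_).bddAbove
    rintro v ⟨y', hy', hle, rfl⟩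
    rw [abs_le] at hle
    refine ⟨y', ⟨hy', ?_, ?_⟩, rfl⟩
    · rw [div_le_iff₀ ht0]; linarith
    · rw [le_div_iff₀ ht0]; linarith
  · filter_upwards [hB] with t ht using le_max_of_le_left (not_lt.1 ht)

/-- A definable family of functions is dominated at `0⁺` by a single definable function. -/
theorem exists_dominating (hfield : ExpandsOrderedField L) (hlom : LocallyOMinimal L)
    (α : Type) [Finite α] : ∀ F : ℝ → (α → ℝ) → ℝ,
    DFun L (fun w : Option α → ℝ => F (w none) fun a => w (some a)) →
    ∃ g : ℝ → ℝ, DFun L (fun v : Fin 1 → ℝ => g (v 0)) ∧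
      ∀ x, ∀ᶠ t in 𝓝[>] 0, F t x ≤ g t := by
  refine Finite.induction_empty_option (P := fun α => Finite α → ∀ F : ℝ → (α → ℝ) → ℝ,
    DFun L (fun w : Option α → ℝ => F (w none) fun a => w (some a)) →
    ∃ g : ℝ → ℝ, DFun L (fun v : Fin 1 → ℝ => g (v 0)) ∧
      ∀ x, ∀ᶠ t in 𝓝[>] 0, F t x ≤ g t) ?_ ?_ ?_ α inferInstance
  · intro α β e ih hβ F hF
    obtain ⟨g, hg, hFg⟩ := ih (Finite.of_injective e e.injective)
      (fun t x => F t fun b => x (e.symm b)) (by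
        refine hF.comp (X := fun w o => o.elim (w none) fun b => w (some (e.symm b))) ?_
        rintro (_ | a) <;> exact DFun.var _)
    exact ⟨g, hg, fun x => by simpa using hFg fun a => x (e a)⟩
  · intro _ F hF
    refine ⟨fun t => F t fun a => a.elim, ?_, fun x => ?_⟩
    · refine hF.comp (X := fun v o => o.elim (v 0) fun a => a.elim) ?_
      rintro (_ | a)
      exacts [DFun.var _, a.elim]
    · rw [Subsingleton.elim x fun a => a.elim]
      exact Filter.Eventually.of_forall fun t => le_rfl
  · intro α _ ih _ F hF
    obtain ⟨G, hG, hFG⟩ := exists_dominating_step hfield hlom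
      (F := fun t y x => F t fun o => o.elim y x) (by
        refine hF.comp (X := fun w o => o.elim (w (some none)) fun o' => o'.elim (w none)
          fun a => w (some (some a))) ?_
        rintro (_ | _ | a) <;> exact DFun.var _)
    obtain ⟨g, hg, hGg⟩ := ih inferInstance G hG
    refine ⟨g, hg, fun x => ?_⟩
    filter_upwards [hFG (x none) fun a => x (some a), hGg fun a => x (some a)] with t h1 h2
    refine le_trans (le_of_eq ?_) (h1.trans h2)
    congr 1
    ext (_ | a) <;> rfl

end Domination

section Monotonicity

theorem monotoneOn_of_eventually_le {u : ℝ → ℝ} {a b : ℝ}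
    (hr : ∀ s ∈ Ioo a b, ∀ᶠ t in 𝓝[>] s, u s ≤ u t)
    (hl : ∀ s ∈ Ioo a b, ∀ᶠ t in 𝓝[<] s, u t ≤ u s) : MonotoneOn u (Ioo a b) := by
  intro x hx y hy hxy
  let S := {t | t ∈ Icc x y ∧ ∀ s ∈ Icc x t, u x ≤ u s}
  have hxS : x ∈ S := ⟨left_mem_Icc.2 hxy, fun s hs => by rw [le_antisymm hs.1 hs.2]⟩
  have hbdd : BddAbove S := ⟨y, fun t ht => ht.1.2⟩
  set c := sSup S
  have hxc : x ≤ c := le_csSup hbdd hxS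
  have hcy : c ≤ y := csSup_le ⟨x, hxS⟩ fun t ht => ht.1.2
  have hcab : c ∈ Ioo a b := ⟨hx.1.trans_le hxc, hcy.trans_lt hy.2⟩
  have hlt : ∀ s, x ≤ s → s < c → u x ≤ u s := fun s hs hsc => by
    obtain ⟨t, ht, hst⟩ := exists_lt_of_lt_csSup ⟨x, hxS⟩ hsc
    exact ht.2 s ⟨hs, hst.le⟩
  have huc : u x ≤ u c := by
    rcases hxc.eq_or_lt with h | h
    · rw [← h]
    · obtain ⟨d, hd, hd'⟩ := mem_nhdsLT_iff_exists_Ioo_subset.1 (hl c hcab)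
      obtain ⟨t, ht1, ht2⟩ := exists_between (max_lt h hd)
      have h3 : u t ≤ u c := hd' ⟨(le_max_right _ _).trans_lt ht1, ht2⟩
      exact (hlt t ((le_max_left _ _).trans ht1.le) ht2).trans h3
  rcases hcy.eq_or_lt with h | h
  · rwa [← h]
  · obtain ⟨d, hd, hd'⟩ := mem_nhdsGT_iff_exists_Ioo_subset.1 (hr c hcab)
    obtain ⟨t, ht1, ht2⟩ := exists_between (lt_min h hd)
    have htS : t ∈ S := by
      refine ⟨⟨hxc.trans ht1.le, ht2.le.trans (min_le_left _ _)⟩, fun s hs => ?_⟩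
      rcases lt_trichotomy s c with h1 | h1 | h1
      · exact hlt s hs.1 h1
      · rwa [h1]
      · have h3 : u c ≤ u s := hd' ⟨h1, (hs.2.trans_lt ht2).trans_le (min_le_right _ _)⟩
        exact huc.trans h3
    exact absurd (le_csSup hbdd htS) (not_le.2 ht1)

theorem antitoneOn_of_eventually_le {u : ℝ → ℝ} {a b : ℝ}
    (hr : ∀ s ∈ Ioo a b, ∀ᶠ t in 𝓝[>] s, u t ≤ u s)
    (hl : ∀ s ∈ Ioo a b, ∀ᶠ t in 𝓝[<] s, u s ≤ u t) : AntitoneOn u (Ioo a b) := by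
  have := monotoneOn_of_eventually_le (u := fun t => -u t)
    (fun s hs => (hr s hs).mono fun t ht => neg_le_neg ht)
    (fun s hs => (hl s hs).mono fun t ht => neg_le_neg ht)
  exact fun x hx y hy hxy => neg_le_neg_iff.1 (this hx hy hxy)

variable {L} {u : ℝ → ℝ}

theorem DPred.forall_Ioo (hfield : ExpandsOrderedField L) {α : Type} [Finite α] {b c : ℝ}
    {R : (α → ℝ) → ℝ → Prop}
    (hR : DPred L fun w : Option α → ℝ => R (fun a => w (some a)) (w none)) :
    DPred L fun v => ∀ s, s ∈ Ioo b c → R v s :=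
  DPred.all (DPred.imp (DPred.and (DPred.lt hfield (DFun.const _) (DFun.var _))
    (DPred.lt hfield (DFun.var _) (DFun.const _))) hR)

variable (hfield : ExpandsOrderedField L) (hlom : LocallyOMinimal L)
  (hu : DFun L fun v : Fin 1 → ℝ => u (v 0))
include hfield hlom hu

theorem eventually_right_le_or_ge :
    (∀ᶠ s in 𝓝[>] 0, ∀ᶠ t in 𝓝[>] s, u s ≤ u t) ∨
      ∀ᶠ s in 𝓝[>] 0, ∀ᶠ t in 𝓝[>] s, u t ≤ u s := by
  refine (hlom.right (p := fun s => ∀ᶠ t in 𝓝[>] s, u s ≤ u t)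
    (DPred.eventually_nhdsGT hfield (R := fun v t => u (v 0) ≤ u t) (S := fun v => v 0)
      (DPred.le hfield (hu.comp_one (DFun.var _)) (hu.comp_one (DFun.var _)))
      (DFun.var _)) 0).imp_right fun h => h.mono fun s hs => ?_
  have := (hlom.right (p := fun t => u s ≤ u t)
    (DPred.le hfield (DFun.const _) hu) s).resolve_left hs
  exact this.mono fun t ht => (not_le.1 ht).le

theorem eventually_left_le_or_ge :
    (∀ᶠ s in 𝓝[>] 0, ∀ᶠ t in 𝓝[<] s, u s ≤ u t) ∨
      ∀ᶠ s in 𝓝[>] 0, ∀ᶠ t in 𝓝[<] s, u t ≤ u s := by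
  refine (hlom.right (p := fun s => ∀ᶠ t in 𝓝[<] s, u s ≤ u t)
    (DPred.eventually_nhdsLT hfield (R := fun v t => u (v 0) ≤ u t) (S := fun v => v 0)
      (DPred.le hfield (hu.comp_one (DFun.var _)) (hu.comp_one (DFun.var _)))
      (DFun.var _)) 0).imp_right fun h => h.mono fun s hs => ?_
  have := (hlom.left (p := fun t => u s ≤ u t)
    (DPred.le hfield (DFun.const _) hu) s).resolve_left hs
  exact this.mono fun t ht => (not_le.1 ht).le

theorem eventually_locally_const_of_eventually_local_min
    (hr : ∀ᶠ s in 𝓝[>] 0, ∀ᶠ t in 𝓝[>] s, u s ≤ u t)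
    (hl : ∀ᶠ s in 𝓝[>] 0, ∀ᶠ t in 𝓝[<] s, u s ≤ u t) :
    ∀ᶠ s in 𝓝[>] 0, (∀ᶠ t in 𝓝[>] s, u t = u s) ∧ ∀ᶠ t in 𝓝[<] s, u t = u s := by
  have hdef : DPred L fun v : Fin 1 → ℝ =>
      (∀ᶠ t in 𝓝[>] v 0, u t = u (v 0)) ∧ ∀ᶠ t in 𝓝[<] v 0, u t = u (v 0) :=
    (DPred.eventually_nhdsGT hfield (R := fun v t => u t = u (v 0)) (S := fun v => v 0)
      (DPred.eq (hu.comp_one (DFun.var _)) (hu.comp_one (DFun.var _))) (DFun.var _)).and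
    (DPred.eventually_nhdsLT hfield (R := fun v t => u t = u (v 0)) (S := fun v => v 0)
      (DPred.eq (hu.comp_one (DFun.var _)) (hu.comp_one (DFun.var _))) (DFun.var _))
  refine (hlom.right (p := fun s => (∀ᶠ t in 𝓝[>] s, u t = u s) ∧ ∀ᶠ t in 𝓝[<] s, u t = u s)
    hdef 0).resolve_right fun hn => ?_
  obtain ⟨e, he : 0 < e, he'⟩ := mem_nhdsGT_iff_exists_Ioo_subset.1 (hn.and (hr.and hl))
  obtain ⟨i, c, d, hcd, h⟩ := hlom.exists_Ioo_of_countable_cover (a := 0) (b := e)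
    (q := fun (i : ℚ × ℚ) t => (t ∈ Ioo (i.1 : ℝ) i.2 ∧ ∀ s, s ∈ Ioo (i.1 : ℝ) i.2 → u t ≤ u s) ∧
      t ∈ Ioo 0 e)
    (fun i => ((DPred.and (DPred.lt hfield (DFun.const _) (DFun.var _))
      (DPred.lt hfield (DFun.var _) (DFun.const _))).and (DPred.forall_Ioo hfield
        (DPred.le hfield (hu.comp_one (DFun.var _)) (hu.comp_one (DFun.var _))))).and
        (DPred.and (DPred.lt hfield (DFun.const _) (DFun.var _))
      (DPred.lt hfield (DFun.var _) (DFun.const _)))) he (by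
      intro t ht
      obtain ⟨-, h1, h2⟩ := he' ht
      obtain ⟨x, hx, hx'⟩ := mem_nhdsLT_iff_exists_Ioo_subset.1 h2
      obtain ⟨y, hy, hy'⟩ := mem_nhdsGT_iff_exists_Ioo_subset.1 h1
      obtain ⟨p, hp1, hp2⟩ := exists_rat_btwn (show x < t from hx)
      obtain ⟨q, hq1, hq2⟩ := exists_rat_btwn (show t < y from hy)
      refine ⟨(p, q), ⟨⟨hp2, hq1⟩, fun s hs => ?_⟩, ht⟩
      rcases lt_trichotomy s t with h | h | h
      · exact hx' ⟨hp1.trans hs.1, h⟩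
      · rw [h]
      · exact hy' ⟨h, hs.2.trans hq2⟩)
  obtain ⟨t, ht⟩ := exists_between hcd
  have heq : ∀ s ∈ Ioo c d, u s = u t := fun s hs =>
    le_antisymm ((h s hs).1.2 t (h t ht).1.1) ((h t ht).1.2 s (h s hs).1.1)
  have hmem : ∀ᶠ s in 𝓝 t, u s = u t := Filter.mem_of_superset (Ioo_mem_nhds ht.1 ht.2) heq
  exact (he' (h t ht).2).1 ⟨nhdsWithin_le_nhds hmem, nhdsWithin_le_nhds hmem⟩

/-- Monotonicity theorem at `0⁺`. -/
theorem exists_monotoneOn_or_antitoneOn :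
    ∃ e, 0 < e ∧ (MonotoneOn u (Ioo 0 e) ∨ AntitoneOn u (Ioo 0 e)) := by
  have hmono : (∀ᶠ s in 𝓝[>] 0, ∀ᶠ t in 𝓝[>] s, u s ≤ u t) →
      (∀ᶠ s in 𝓝[>] 0, ∀ᶠ t in 𝓝[<] s, u t ≤ u s) → ∃ e, 0 < e ∧ MonotoneOn u (Ioo 0 e) := by
    intro h1 h2
    obtain ⟨e, he, he'⟩ := mem_nhdsGT_iff_exists_Ioo_subset.1 (h1.and h2)
    exact ⟨e, he, monotoneOn_of_eventually_le (fun s hs => (he' hs).1) fun s hs => (he' hs).2⟩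
  rcases eventually_right_le_or_ge hfield hlom hu with h1 | h1 <;>
    rcases eventually_left_le_or_ge hfield hlom hu with h2 | h2
  · have := eventually_locally_const_of_eventually_local_min hfield hlom hu h1 h2
    obtain ⟨e, he, h⟩ := hmono h1 (this.mono fun s hs => hs.2.mono fun t ht => ht.le)
    exact ⟨e, he, Or.inl h⟩
  · obtain ⟨e, he, h⟩ := hmono h1 h2
    exact ⟨e, he, Or.inl h⟩
  · obtain ⟨e, he, he'⟩ := mem_nhdsGT_iff_exists_Ioo_subset.1 (h1.and h2)
    exact ⟨e, he, Or.inr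
      (antitoneOn_of_eventually_le (fun s hs => (he' hs).1) fun s hs => (he' hs).2)⟩
  · have := eventually_locally_const_of_eventually_local_min (u := fun t => -u t) hfield hlom
      (DFun.neg hfield hu)
      (h1.mono fun s hs => hs.mono fun t ht => neg_le_neg ht)
      (h2.mono fun s hs => hs.mono fun t ht => neg_le_neg ht)
    obtain ⟨e, he, h⟩ := hmono
      (this.mono fun s hs => hs.1.mono fun t ht => (neg_injective ht).ge) h2
    exact ⟨e, he, Or.inl h⟩

end Monotonicity

section Derivative

variable {L} {u : ℝ → ℝ}

theorem hasDerivAt_iff_forall_exists {s d : ℝ} : HasDerivAt u d s ↔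
    ∀ e, 0 < e → ∃ δ, 0 < δ ∧ ∀ y, |y - s| < δ → |u y - u s - (y - s) * d| ≤ e * |y - s| := by
  simp only [hasDerivAt_iff_isLittleO, Asymptotics.isLittleO_iff, Metric.eventually_nhds_iff,
    Real.dist_eq, Real.norm_eq_abs, smul_eq_mul]

variable (hfield : ExpandsOrderedField L) (hu : DFun L fun v : Fin 1 → ℝ => u (v 0))
include hfield hu

theorem DPred.hasDerivAt {α : Type} [Finite α] {S D : (α → ℝ) → ℝ} (hS : DFun L S)
    (hD : DFun L D) : DPred L fun v => HasDerivAt u (D v) (S v) := by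
  simp only [hasDerivAt_iff_forall_exists]
  refine DPred.all (DPred.imp (DPred.lt hfield (DFun.const _) (DFun.var _)) (DPred.ex (DPred.and
    (DPred.lt hfield (DFun.const _) (DFun.var _)) (DPred.all (DPred.imp ?_ ?_)))))
  all_goals
    have hS' : DFun L fun w : Option (Option (Option α)) → ℝ => S fun a => w (some (some (some a))) :=
      hS.comp fun _ => DFun.var _
    have hD' : DFun L fun w : Option (Option (Option α)) → ℝ => D fun a => w (some (some (some a))) :=
      hD.comp fun _ => DFun.var _
    have hyS := DFun.sub hfield (DFun.var none) hS'
  · exact DPred.lt hfield (DFun.abs hfield hyS) (DFun.var _)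
  · exact DPred.le hfield (DFun.abs hfield (DFun.sub hfield (DFun.sub hfield
      (hu.comp_one (DFun.var _)) (hu.comp_one hS')) (DFun.mul hfield hyS hD')))
      (DFun.mul hfield (DFun.var _) (DFun.abs hfield hyS))

theorem DPred.differentiableAt {α : Type} [Finite α] {S : (α → ℝ) → ℝ} (hS : DFun L S) :
    DPred L fun v => DifferentiableAt ℝ u (S v) := by
  have : DPred L fun v => ∃ d, HasDerivAt u d (S v) :=
    DPred.ex (DPred.hasDerivAt hfield hu (hS.comp fun _ => DFun.var _) (DFun.var _))
  convert this using 2 with v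
  exact ⟨fun h => ⟨_, h.hasDerivAt⟩, fun ⟨d, h⟩ => h.differentiableAt⟩

theorem DFun.deriv : DFun L fun v : Fin 1 → ℝ => deriv u (v 0) := by
  refine DFun.of_graph ?_
  have h : DPred L fun w : Option (Fin 1) → ℝ => HasDerivAt u (w none) (w (some 0)) ∨
      ¬ DifferentiableAt ℝ u (w (some 0)) ∧ w none = 0 :=
    (DPred.hasDerivAt hfield hu (DFun.var _) (DFun.var _)).or
      ((DPred.differentiableAt hfield hu (DFun.var _)).not.and
        (DPred.eq (DFun.var _) (DFun.const 0)))
  convert h using 2 with w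
  by_cases hd : DifferentiableAt ℝ u (w (some 0))
  · simp only [hd, not_true, false_and, or_false]
    exact ⟨fun e => e ▸ hd.hasDerivAt, fun e => e.deriv⟩
  · have : ¬ HasDerivAt u (w none) (w (some 0)) := fun h => hd h.differentiableAt
    simp [hd, this, deriv_zero_of_not_differentiableAt hd, eq_comm]

theorem DFun.iteratedDeriv (n : ℕ) : DFun L fun v : Fin 1 → ℝ => iteratedDeriv n u (v 0) := by
  induction n with
  | zero => simpa using hu
  | succ n ih =>
    rw [iteratedDeriv_succ]
    exact DFun.deriv hfield ih

theorem eventually_differentiableAt (hlom : LocallyOMinimal L) :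
    ∀ᶠ t in 𝓝[>] 0, DifferentiableAt ℝ u t := by
  refine (hlom.right (p := fun t => DifferentiableAt ℝ u t)
    (DPred.differentiableAt hfield hu (DFun.var _)) 0).resolve_right fun hn => ?_
  obtain ⟨e, he : 0 < e, hmon⟩ := exists_monotoneOn_or_antitoneOn hfield hlom hu
  obtain ⟨d, hd : 0 < d, hd'⟩ := mem_nhdsGT_iff_exists_Ioo_subset.1 hn
  have hae : ∀ᵐ x, x ∈ Ioo 0 e → DifferentiableAt ℝ u x := by
    have key : ∀ᵐ x, x ∈ Ioo 0 e → DifferentiableWithinAt ℝ u (Ioo 0 e) x := by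
      rcases hmon with h | h
      · exact h.ae_differentiableWithinAt_of_mem
      · filter_upwards [h.neg.ae_differentiableWithinAt_of_mem] with x hx hxe
        simpa using (hx hxe).neg
    filter_upwards [key] with x hx hxe
    exact (hx hxe).differentiableAt (Ioo_mem_nhds hxe.1 hxe.2)
  have hnull : MeasureTheory.volume (Ioo 0 (min d e)) = 0 := by
    refine MeasureTheory.measure_mono_null (fun x hx => ?_) hae
    simp only [mem_compl_iff]
    intro hc
    exact hd' ⟨hx.1, hx.2.trans_le (min_le_left _ _)⟩
      (hc ⟨hx.1, hx.2.trans_le (min_le_right _ _)⟩)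
  simp [hd.not_ge, he.not_ge] at hnull

theorem eventually_differentiableAt_iteratedDeriv (hlom : LocallyOMinimal L) (r : ℕ) :
    ∀ᶠ t in 𝓝[>] 0, ∀ n ≤ r, DifferentiableAt ℝ (iteratedDeriv n u) t := by
  have := (Filter.eventually_all_finset (Finset.range (r + 1))).2 fun n _ =>
    eventually_differentiableAt hfield (DFun.iteratedDeriv hfield hu n) hlom
  exact this.mono fun t ht n hn => ht n (by simpa [Nat.lt_succ_iff] using hn)

theorem exists_contDiffOn (hlom : LocallyOMinimal L) (r : ℕ) :
    ∃ e, 0 < e ∧ ContDiffOn ℝ r u (Ioo 0 e) := by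
  obtain ⟨e, he, h⟩ := mem_nhdsGT_iff_exists_Ioo_subset.1
    (eventually_differentiableAt_iteratedDeriv hfield hu hlom r)
  refine ⟨e, he, contDiffOn_of_differentiableOn_deriv fun m hm => ?_⟩
  have hm' : m ≤ r := by exact_mod_cast hm
  refine DifferentiableOn.congr (f := iteratedDeriv m u)
    (fun t ht => (h ht m hm').differentiableWithinAt) fun t ht => ?_
  exact iteratedDerivWithin_of_isOpen isOpen_Ioo ht

end Derivative

section Flat

open Filter Asymptotics

theorem not_eventually_lt_deriv_of_isLittleO {h : ℝ → ℝ} {n : ℕ}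
    (hd : ∀ᶠ t in 𝓝[>] 0, DifferentiableAt ℝ h t)
    (ho : h =o[𝓝[>] 0] fun t => t ^ (n + 1)) {c : ℝ} (hc : 0 < c) :
    ¬ ∀ᶠ t in 𝓝[>] 0, c * t ^ n < deriv h t := by
  intro hlt
  have hn : (0 : ℝ) < n + 1 := by positivity
  obtain ⟨e, he : 0 < e, h1⟩ := mem_nhdsGT_iff_exists_Ioo_subset.1 (hd.and hlt)
  let k : ℝ → ℝ := fun t => h t - c / (n + 1) * t ^ (n + 1)
  have hk : ∀ t ∈ Ioo 0 e, HasDerivAt k (deriv h t - c * t ^ n) t := by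
    intro t ht
    have h2 := (h1 ht).1.hasDerivAt.fun_sub ((hasDerivAt_pow (n + 1) t).const_mul (c / (n + 1)))
    have h3 : c / (n + 1) * (((n + 1 : ℕ) : ℝ) * t ^ (n + 1 - 1)) = c * t ^ n := by
      rw [Nat.add_sub_cancel]
      push_cast
      field_simp
    rwa [h3] at h2
  have hmono : MonotoneOn k (Ioo 0 e) := by
    refine monotoneOn_of_deriv_nonneg (convex_Ioo 0 e)
      (fun t ht => (hk t ht).continuousAt.continuousWithinAt)
      (fun t ht => (hk t (interior_subset ht)).differentiableAt.differentiableWithinAt)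
      fun t ht => ?_
    rw [(hk t (interior_subset ht)).deriv, sub_nonneg]
    exact (h1 (interior_subset ht)).2.le
  have hpow : Tendsto (fun t : ℝ => t ^ (n + 1)) (𝓝[>] 0) (𝓝 0) := by
    have : ContinuousAt (fun t : ℝ => t ^ (n + 1)) 0 := by fun_prop
    simpa [ContinuousAt] using this.mono_left nhdsWithin_le_nhds
  have hk0 : Tendsto k (𝓝[>] 0) (𝓝 0) := by
    simpa using (ho.trans_tendsto hpow).sub (hpow.const_mul (c / (n + 1)))
  have hnonneg : ∀ t ∈ Ioo 0 e, 0 ≤ k t := fun t ht =>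
    le_of_tendsto hk0 (mem_of_superset (Ioo_mem_nhdsGT ht.1) fun s hs =>
      hmono ⟨hs.1, hs.2.trans ht.2⟩ ht hs.2.le)
  have hsmall := isLittleO_iff.1 ho (show 0 < c / (n + 1) / 2 by positivity)
  obtain ⟨t, h2, ht⟩ := (hsmall.and (Ioo_mem_nhdsGT he)).exists
  have h3 := hnonneg t ht
  have hp : 0 < t ^ (n + 1) := pow_pos ht.1 _
  rw [Real.norm_eq_abs, Real.norm_of_nonneg hp.le] at h2
  have h4 := (le_abs_self _).trans h2
  have h5 : 0 < c / (n + 1) * t ^ (n + 1) := by positivity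
  simp only [k] at h3
  nlinarith

variable {L} {u : ℝ → ℝ} (hfield : ExpandsOrderedField L) (hlom : LocallyOMinimal L)

include hfield hlom

theorem isLittleO_deriv (hu : DFun L fun v : Fin 1 → ℝ => u (v 0)) {n : ℕ}
    (ho : u =o[𝓝[>] 0] fun t => t ^ (n + 1)) : deriv u =o[𝓝[>] 0] fun t => t ^ n := by
  have key : ∀ {h : ℝ → ℝ}, (DFun L fun v : Fin 1 → ℝ => h (v 0)) →
      (h =o[𝓝[>] 0] fun t => t ^ (n + 1)) → ∀ {c : ℝ}, 0 < c →
      ∀ᶠ t in 𝓝[>] 0, deriv h t ≤ c * t ^ n := by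
    intro h hh ho c hc
    have := (hlom.right (p := fun t => c * t ^ n < deriv h t) (DPred.lt hfield
      (DFun.mul hfield (DFun.const _) (DFun.pow hfield (DFun.var _) _))
      (DFun.deriv hfield hh)) 0).resolve_left
      (not_eventually_lt_deriv_of_isLittleO (eventually_differentiableAt hfield hh hlom) ho hc)
    exact this.mono fun t ht => not_lt.1 ht
  refine isLittleO_iff.2 fun c hc => ?_
  filter_upwards [key hu ho hc, key (h := fun t => -u t) (DFun.neg hfield hu) ho.neg_left hc,
    self_mem_nhdsWithin] with t h1 h2 (ht : 0 < t)
  rw [deriv.fun_neg] at h2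
  rw [Real.norm_eq_abs, Real.norm_of_nonneg (pow_pos ht n).le, abs_le]
  exact ⟨by linarith, h1⟩

theorem isLittleO_iteratedDeriv (hu : DFun L fun v : Fin 1 → ℝ => u (v 0)) {n m : ℕ}
    (ho : u =o[𝓝[>] 0] fun t => t ^ (n + m)) :
    iteratedDeriv m u =o[𝓝[>] 0] fun t => t ^ n := by
  induction m generalizing n with
  | zero => simpa using ho
  | succ m ih =>
    rw [iteratedDeriv_succ]
    refine isLittleO_deriv hfield hlom (DFun.iteratedDeriv hfield hu m) (ih ?_)
    rwa [show n + 1 + m = n + (m + 1) by ring]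

theorem tendsto_iteratedDeriv_zero (hu : DFun L fun v : Fin 1 → ℝ => u (v 0)) {r m : ℕ}
    (hm : m ≤ r) (ho : u =o[𝓝[>] 0] fun t => t ^ r) :
    Tendsto (iteratedDeriv m u) (𝓝[>] 0) (𝓝 0) := by
  obtain ⟨n, rfl⟩ := Nat.exists_eq_add_of_le' hm
  have h1 := isLittleO_iteratedDeriv hfield hlom hu ho
  have h2 : (fun t : ℝ => t ^ n) =O[𝓝[>] 0] fun _ => (1 : ℝ) :=
    (((continuous_pow n).tendsto 0).mono_left nhdsWithin_le_nhds).isBigO_one ℝ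
  exact (isLittleO_one_iff ℝ).1 (h1.trans_isBigO h2)

omit hfield hlom

theorem contDiff_of_tendsto_iteratedDeriv_zero {r : ℕ} {F : ℝ → ℝ} (h0 : F 0 = 0)
    (hF : ContDiffOn ℝ r F {0}ᶜ)
    (hlim : ∀ i ≤ r, Tendsto (iteratedDeriv i F) (𝓝[≠] 0) (𝓝 0)) :
    ContDiff ℝ r F ∧ ∀ i ≤ r, iteratedDeriv i F 0 = 0 := by
  have hopen : IsOpen ({0}ᶜ : Set ℝ) := isOpen_compl_singleton
  induction r generalizing F with
  | zero =>
    refine ⟨?_, fun i hi => by simpa [Nat.le_zero.1 hi] using h0⟩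
    rw [Nat.cast_zero, contDiff_zero, continuous_iff_continuousAt]
    intro x
    by_cases hx : x = 0
    · subst hx
      rw [continuousAt_iff_punctured_nhds, h0]
      simpa using hlim 0 le_rfl
    · exact hF.continuousOn.continuousAt (hopen.mem_nhds hx)
  | succ r ih =>
    have hdiff : ∀ x ≠ 0, DifferentiableAt ℝ F x := fun x hx =>
      (hF.differentiableOn (by simp)).differentiableAt (hopen.mem_nhds hx)
    have hlim1 : Tendsto (deriv F) (𝓝[≠] 0) (𝓝 0) := by
      simpa using hlim 1 (by omega)
    have hderiv : HasDerivAt F 0 0 := by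
      have := hasDerivAt_of_hasDerivAt_of_ne (f := F) (g := Function.update (deriv F) 0 0) (x := 0)
        (fun y hy => by simpa [hy] using (hdiff y hy).hasDerivAt)
        (by
          rw [continuousAt_iff_punctured_nhds, h0]
          simpa using hlim 0 (by omega))
        (by simpa [continuousAt_update_same] using hlim1)
      simpa using this
    obtain ⟨h1, h2⟩ := ih (F := deriv F) hderiv.deriv
      (hF.deriv_of_isOpen hopen (by simp)) (fun i hi => by
        rw [← iteratedDeriv_succ']
        exact hlim (i + 1) (by omega))
    refine ⟨?_, fun i hi => ?_⟩
    · rw [Nat.cast_add, Nat.cast_one, contDiff_succ_iff_deriv]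
      refine ⟨fun x => ?_, by simp, h1⟩
      by_cases hx : x = 0
      · exact hx ▸ hderiv.differentiableAt
      · exact hdiff x hx
    · cases i with
      | zero => simpa using h0
      | succ i =>
        rw [iteratedDeriv_succ']
        exact h2 i (by omega)

theorem tendsto_iteratedDeriv_zero_of_odd {F : ℝ → ℝ} (hodd : ∀ t, F (-t) = -F t) {i : ℕ}
    (h : Tendsto (iteratedDeriv i F) (𝓝[>] 0) (𝓝 0)) :
    Tendsto (iteratedDeriv i F) (𝓝[≠] 0) (𝓝 0) := by
  rw [← nhdsLT_sup_nhdsGT, tendsto_sup]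
  refine ⟨?_, h⟩
  have hnorm : ∀ t, ‖iteratedDeriv i F (-t)‖ = ‖iteratedDeriv i F t‖ := fun t => by
    have h1 := iteratedDeriv_comp_neg i F t
    simp only [hodd] at h1
    rw [iteratedDeriv_fun_neg] at h1
    have h2 := congrArg norm h1
    rw [norm_neg, norm_smul] at h2
    simpa using h2.symm
  have hneg : Tendsto (fun t : ℝ => -t) (𝓝[<] 0) (𝓝[>] 0) := by
    simpa using tendsto_neg_nhdsLT (a := (0 : ℝ))
  rw [tendsto_zero_iff_norm_tendsto_zero] at h ⊢
  exact (h.comp hneg).congr hnorm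

end Flat

section Rate

open Filter Asymptotics

variable {L}

/-- A positive definable `C^r` rate at `0⁺`, monotone, `O(t^(r+1))`, and small against `1/|g|`. -/
theorem exists_rate (hfield : ExpandsOrderedField L) (hlom : LocallyOMinimal L) (r : ℕ)
    {g : ℝ → ℝ} (hg : DFun L fun v : Fin 1 → ℝ => g (v 0)) :
    ∃ (u : ℝ → ℝ) (e : ℝ), DFun L (fun v : Fin 1 → ℝ => u (v 0)) ∧ 0 < e ∧ e ≤ 1 ∧
      ContDiffOn ℝ r u (Ioo 0 e) ∧ MonotoneOn u (Ioo 0 e) ∧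
      (∀ t, 0 < t → 0 < u t) ∧ (∀ t, 0 < t → u t ≤ t ^ (r + 1)) ∧
      ∀ t, 0 < t → u t * |g t| ≤ t ^ (r + 1) := by
  let u : ℝ → ℝ := fun t => t ^ (r + 1) / (1 + |g t|)
  have hu : DFun L fun v : Fin 1 → ℝ => u (v 0) :=
    DFun.div hfield (DFun.pow hfield (DFun.var _) _)
      (DFun.add hfield (DFun.const _) (DFun.abs hfield hg))
  have hpos : ∀ t, 0 < t → 0 < u t := fun t ht => by positivity
  have hle : ∀ t, 0 < t → u t ≤ t ^ (r + 1) := fun t ht =>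
    div_le_self (by positivity) (by linarith [abs_nonneg (g t)])
  obtain ⟨e₁, he₁, hmono⟩ := exists_monotoneOn_or_antitoneOn hfield hlom hu
  obtain ⟨e₂, he₂, hsmooth⟩ := exists_contDiffOn hfield hu hlom r
  have hmono' : MonotoneOn u (Ioo 0 e₁) := by
    refine hmono.resolve_right fun hanti => ?_
    have h0 : Tendsto (fun t : ℝ => t ^ (r + 1)) (𝓝[>] 0) (𝓝 0) := by
      have : ContinuousAt (fun t : ℝ => t ^ (r + 1)) 0 := by fun_prop
      simpa [ContinuousAt] using this.mono_left nhdsWithin_le_nhds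
    have h1 : u (e₁ / 2) ≤ 0 := by
      refine ge_of_tendsto h0 ?_
      filter_upwards [Ioo_mem_nhdsGT (half_pos he₁)] with t ht
      exact (hanti ⟨ht.1, by linarith [ht.2]⟩ ⟨by linarith, by linarith⟩ ht.2.le).trans
        (hle t ht.1)
    exact (hpos _ (half_pos he₁)).not_ge h1
  refine ⟨u, min (min e₁ e₂) 1, hu, by positivity, min_le_right _ _,
    hsmooth.mono (Ioo_subset_Ioo_right ((min_le_left _ _).trans (min_le_right _ _))),
    hmono'.mono (Ioo_subset_Ioo_right ((min_le_left _ _).trans (min_le_left _ _))),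
    hpos, hle, fun t ht => ?_⟩
  rw [div_mul_eq_mul_div, div_le_iff₀ (by positivity)]
  have : 0 < t ^ (r + 1) := by positivity
  nlinarith

/-- The odd extension of `t ↦ (1 + t) * u (e * t / (1 + t))`, `t > 0`. -/
noncomputable def oddStretch (u : ℝ → ℝ) (e t : ℝ) : ℝ :=
  if 0 < t then (1 + t) * u (e * t / (1 + t))
  else if t < 0 then -((1 + -t) * u (e * -t / (1 + -t))) else 0

variable {u : ℝ → ℝ} {e : ℝ}

theorem oddStretch_of_pos {t : ℝ} (ht : 0 < t) :
    oddStretch u e t = (1 + t) * u (e * t / (1 + t)) := if_pos ht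

theorem oddStretch_zero : oddStretch u e 0 = 0 := by simp [oddStretch]

theorem oddStretch_neg (t : ℝ) : oddStretch u e (-t) = -oddStretch u e t := by
  rcases lt_trichotomy t 0 with h | rfl | h
  · simp [oddStretch, h, h.not_gt]
  · simp [oddStretch]
  · simp [oddStretch, h, h.not_gt]

theorem DFun.oddStretch (hfield : ExpandsOrderedField L)
    (hu : DFun L fun v : Fin 1 → ℝ => u (v 0)) :
    DFun L fun v : Fin 1 → ℝ => oddStretch u e (v 0) := by
  have h : ∀ {T : (Fin 1 → ℝ) → ℝ}, DFun L T →
      DFun L fun v => (1 + T v) * u (e * T v / (1 + T v)) := fun hT =>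
    DFun.mul hfield (DFun.add hfield (DFun.const _) hT) (hu.comp_one
      (DFun.div hfield (DFun.mul hfield (DFun.const _) hT) (DFun.add hfield (DFun.const _) hT)))
  exact DFun.ite (DPred.lt hfield (DFun.const _) (DFun.var _)) (h (DFun.var _))
    (DFun.ite (DPred.lt hfield (DFun.var _) (DFun.const _))
      (DFun.neg hfield (h (DFun.neg hfield (DFun.var _)))) (DFun.const _))

theorem mul_div_one_add_mem_Ioo (he : 0 < e) {t : ℝ} (ht : 0 < t) :
    e * t / (1 + t) ∈ Ioo 0 e := by
  refine ⟨by positivity, ?_⟩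
  rw [div_lt_iff₀ (by positivity)]
  nlinarith

theorem mul_div_one_add_le (he : 0 < e) {s t : ℝ} (hs : 0 < s) (hst : s ≤ t) :
    e * s / (1 + s) ≤ e * t / (1 + t) := by
  rw [div_le_div_iff₀ (by positivity) (by linarith)]
  nlinarith

theorem strictMono_oddStretch (he : 0 < e) (hmono : MonotoneOn u (Ioo 0 e))
    (hpos : ∀ t, 0 < t → 0 < u t) : StrictMono (oddStretch u e) := by
  refine strictMono_of_odd_strictMonoOn_nonneg oddStretch_neg ?_
  intro s (hs : 0 ≤ s) t _ hst
  have ht : 0 < t := hs.trans_lt hst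
  have hut := hpos _ (mul_div_one_add_mem_Ioo he ht).1
  rw [oddStretch_of_pos ht]
  rcases hs.eq_or_lt with rfl | hs
  · rw [oddStretch_zero]
    positivity
  · rw [oddStretch_of_pos hs]
    exact mul_lt_mul (by linarith) (hmono (mul_div_one_add_mem_Ioo he hs)
      (mul_div_one_add_mem_Ioo he ht) (mul_div_one_add_le he hs hst.le))
      (hpos _ (mul_div_one_add_mem_Ioo he hs).1) (by linarith)

theorem contDiffOn_oddStretch (he : 0 < e) {r : ℕ} (hu : ContDiffOn ℝ r u (Ioo 0 e)) :
    ContDiffOn ℝ r (oddStretch u e) {0}ᶜ := by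
  have hpos : ContDiffOn ℝ r (oddStretch u e) (Ioi 0) := by
    have hθ : ContDiffOn ℝ r (fun t : ℝ => e * t / (1 + t)) (Ioi 0) :=
      (contDiffOn_const.mul contDiffOn_id).div (contDiffOn_const.add contDiffOn_id)
        fun t (ht : 0 < t) => by positivity
    exact ((contDiffOn_const.add contDiffOn_id).mul
      (hu.comp hθ fun t ht => mul_div_one_add_mem_Ioo he ht)).congr fun t ht =>
        oddStretch_of_pos ht
  have hneg : ContDiffOn ℝ r (oddStretch u e) (Iio 0) :=
    (hpos.comp contDiffOn_id.neg (fun t (ht : t < 0) => neg_pos.2 ht)).neg.congr fun t _ => by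
      simp [oddStretch_neg]
  rw [← Iio_union_Ioi]
  exact hneg.union_of_isOpen hpos isOpen_Iio isOpen_Ioi

theorem oddStretch_le (he : 0 < e) (he1 : e ≤ 1) (hmono : MonotoneOn u (Ioo 0 e))
    (hpos : ∀ t, 0 < t → 0 < u t) {t : ℝ} (ht : t ∈ Ioo 0 e) : oddStretch u e t ≤ 2 * u t := by
  rw [oddStretch_of_pos ht.1]
  have ht0 := ht.1
  have h1 : e * t / (1 + t) ≤ t := by
    rw [div_le_iff₀ (by positivity)]
    nlinarith
  exact mul_le_mul (by linarith [ht.2]) (hmono (mul_div_one_add_mem_Ioo he ht.1) ht h1)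
    (hpos _ (mul_div_one_add_mem_Ioo he ht.1).1).le zero_le_two

theorem surjective_oddStretch (he : 0 < e) (hmono : MonotoneOn u (Ioo 0 e))
    (hpos : ∀ t, 0 < t → 0 < u t) (hcont : Continuous (oddStretch u e)) :
    Function.Surjective (oddStretch u e) := by
  have htop : Tendsto (oddStretch u e) atTop atTop := by
    have h1 : Tendsto (fun t : ℝ => (1 + t) * u (e * 1 / (1 + 1))) atTop atTop :=
      (tendsto_atTop_add_const_left _ 1 tendsto_id).atTop_mul_const (hpos _ (by positivity))
    refine tendsto_atTop_mono' _ ?_ h1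
    filter_upwards [eventually_ge_atTop 1] with t ht
    have ht0 : 0 < t := by linarith
    rw [oddStretch_of_pos ht0]
    exact mul_le_mul_of_nonneg_left (hmono (mul_div_one_add_mem_Ioo he one_pos)
      (mul_div_one_add_mem_Ioo he ht0) (mul_div_one_add_le he one_pos ht)) (by linarith)
  refine hcont.surjective htop ?_
  refine (tendsto_neg_atTop_atBot.comp (htop.comp tendsto_neg_atBot_atTop)).congr fun t => ?_
  simp [oddStretch_neg]

theorem isLittleO_oddStretch (he : 0 < e) (he1 : e ≤ 1) (hmono : MonotoneOn u (Ioo 0 e))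
    (hpos : ∀ t, 0 < t → 0 < u t) {r : ℕ} (hle : ∀ t, 0 < t → u t ≤ t ^ (r + 1)) :
    oddStretch u e =o[𝓝[>] 0] fun t => t ^ r := by
  have h1 : oddStretch u e =O[𝓝[>] 0] fun t => t ^ (r + 1) := by
    refine IsBigO.of_bound 2 ?_
    filter_upwards [Ioo_mem_nhdsGT he] with t ht
    have h0 : 0 < oddStretch u e t := by
      simpa [oddStretch_zero] using strictMono_oddStretch he hmono hpos ht.1
    rw [Real.norm_of_nonneg h0.le, Real.norm_of_nonneg (pow_pos ht.1 _).le]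
    linarith [oddStretch_le he he1 hmono hpos ht, hle t ht.1]
  exact h1.trans_isLittleO ((isLittleO_pow_pow (lt_add_one r)).mono nhdsWithin_le_nhds)

end Rate

section Main

open Filter

variable {L}

theorem x2_snoc_snoc {m : ℕ} (x : Fin m → ℝ) (t y : ℝ) :
    x2 (Fin.snoc (α := fun _ => ℝ) (Fin.snoc (α := fun _ => ℝ) x t) y) = x :=
  funext fun _ => (Fin.snoc_castSucc (α := fun _ => ℝ) _ _ _).trans
    (Fin.snoc_castSucc (α := fun _ => ℝ) _ _ _)

theorem t2_snoc_snoc {m : ℕ} (x : Fin m → ℝ) (t y : ℝ) :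
    t2 (Fin.snoc (α := fun _ => ℝ) (Fin.snoc (α := fun _ => ℝ) x t) y) = t :=
  (Fin.snoc_castSucc (α := fun _ => ℝ) _ _ _).trans (Fin.snoc_last (α := fun _ => ℝ) _ _)

theorem v2_snoc {m : ℕ} (z : Fin (m + 1) → ℝ) (y : ℝ) :
    v2 (Fin.snoc (α := fun _ => ℝ) z y) = y :=
  Fin.snoc_last (α := fun _ => ℝ) _ _

theorem DFun.abs_indicator {m : ℕ} {A : Set (Fin m → ℝ)} {f : (Fin m → ℝ) → ℝ → ℝ}
    (hfield : ExpandsOrderedField L) (hA : Def L m A)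
    (hf : Def L (m + 1 + 1) {z | x2 z ∈ A ∧ 0 < t2 z ∧ v2 z = f (x2 z) (t2 z)})
    [∀ (w : Option (Fin m) → ℝ), Decidable ((fun i => w (some i)) ∈ A ∧ 0 < w none)] :
    DFun L fun w : Option (Fin m) → ℝ =>
      |if (fun i => w (some i)) ∈ A ∧ 0 < w none then f (fun i => w (some i)) (w none) else 0| := by
  refine DFun.abs hfield (DFun.of_graph ?_)
  have hdom : DPred L fun w : Option (Option (Fin m)) → ℝ =>
      (fun i => w (some (some i))) ∈ A ∧ 0 < w (some none) :=
    (DPred.comp (R := fun x => x ∈ A) hA (X := fun w i => w (some (some i)))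
      fun i => DFun.var _).and (DPred.lt hfield (DFun.const 0) (DFun.var _))
  have hgraph : DPred L fun w : Option (Option (Fin m)) → ℝ =>
      (fun i => w (some (some i))) ∈ A ∧ 0 < w (some none) ∧
        w none = f (fun i => w (some (some i))) (w (some none)) := by
    have := DPred.comp (R := fun z : Fin (m + 1 + 1) → ℝ =>
      x2 z ∈ A ∧ 0 < t2 z ∧ v2 z = f (x2 z) (t2 z)) hf
      (X := fun w : Option (Option (Fin m)) → ℝ => Fin.snoc (α := fun _ => ℝ)
        (Fin.snoc (α := fun _ => ℝ) (fun i => w (some (some i))) (w (some none))) (w none)) (by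
        intro b
        refine Fin.lastCases ?_ (fun b => Fin.lastCases ?_ (fun b => ?_) b) b
        all_goals simp only [Fin.snoc_last, Fin.snoc_castSucc]
        all_goals exact DFun.var _)
    convert this using 2 with w
    simp only [x2_snoc_snoc, t2_snoc_snoc, v2_snoc]
  have key := hgraph.or (hdom.not.and (DPred.eq (DFun.var none) (DFun.const 0)))
  convert key using 2 with w
  split_ifs with h
  · simp [h, eq_comm]
  · simp only [h, not_false_eq_true, true_and, ← and_assoc, false_and, false_or]
    exact eq_comm

end Main

/-- given a definable function `f` on `A × (0,∞)`, there is an odd strictly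
increasing definable `C^r` bijection `φ : ℝ → ℝ`, `r`-flat at `0`, such that
`φ(t)·f(x,t) → 0` as `t → 0⁺` for every `x ∈ A`. -/
theorem statement19
    (hfield : ExpandsOrderedField L) (hlom : LocallyOMinimal L)
    (r m : ℕ) (A : Set (Fin m → ℝ)) (hA : Def L m A)
    (f : (Fin m → ℝ) → ℝ → ℝ)
    (hf : Def L (m + 1 + 1) {z | x2 z ∈ A ∧ 0 < t2 z ∧ v2 z = f (x2 z) (t2 z)}) :
    ∃ φ : ℝ → ℝ,
      Def L 2 {z : Fin 2 → ℝ | z 1 = φ (z 0)} ∧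
      Function.Bijective φ ∧ StrictMono φ ∧ (∀ t : ℝ, φ (-t) = -φ t) ∧
      ContDiff ℝ r φ ∧ φ 0 = 0 ∧ (∀ i : ℕ, i ≤ r → iteratedDeriv i φ 0 = 0) ∧
      ∀ x ∈ A, Filter.Tendsto (fun t => φ t * f x t)
        (nhdsWithin 0 (Set.Ioi 0)) (nhds 0) := by
  classical
  obtain ⟨g, hg, hfg⟩ := exists_dominating hfield hlom (Fin m)
    (fun t x => |if x ∈ A ∧ 0 < t then f x t else 0|) (DFun.abs_indicator hfield hA hf)
  obtain ⟨u, e, hu, he, he1, hsmooth, hmono, hpos, hle, hug⟩ := exists_rate hfield hlom r hg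
  have hφ : DFun L fun v : Fin 1 → ℝ => oddStretch u e (v 0) := DFun.oddStretch hfield hu
  have hlim : ∀ i ≤ r, Filter.Tendsto (iteratedDeriv i (oddStretch u e)) (𝓝[≠] 0) (𝓝 0) :=
    fun i hi => tendsto_iteratedDeriv_zero_of_odd oddStretch_neg
      (tendsto_iteratedDeriv_zero hfield hlom hφ hi (isLittleO_oddStretch he he1 hmono hpos hle))
  obtain ⟨hcd, hflat⟩ := contDiff_of_tendsto_iteratedDeriv_zero oddStretch_zero
    (contDiffOn_oddStretch he hsmooth) hlim
  have hstrict := strictMono_oddStretch he hmono hpos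
  refine ⟨oddStretch u e, DPred.eq (DFun.var 1) (hφ.comp_one (DFun.var 0)),
    ⟨hstrict.injective, surjective_oddStretch he hmono hpos hcd.continuous⟩, hstrict,
    oddStretch_neg, hcd, oddStretch_zero, hflat, fun x hx => ?_⟩
  have hpow : Filter.Tendsto (fun t : ℝ => 2 * t ^ (r + 1)) (𝓝[>] 0) (𝓝 0) := by
    have : ContinuousAt (fun t : ℝ => 2 * t ^ (r + 1)) 0 := by fun_prop
    simpa [ContinuousAt] using this.mono_left nhdsWithin_le_nhds
  refine squeeze_zero_norm' ?_ hpow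
  filter_upwards [hfg x, Ioo_mem_nhdsGT he] with t hft ht
  rw [if_pos ⟨hx, ht.1⟩] at hft
  have h0 : 0 < oddStretch u e t := by simpa [oddStretch_zero] using hstrict ht.1
  rw [norm_mul, Real.norm_of_nonneg h0.le, Real.norm_eq_abs]
  calc oddStretch u e t * |f x t| ≤ 2 * u t * |g t| :=
        mul_le_mul (oddStretch_le he he1 hmono hpos ht) (hft.trans (le_abs_self _))
          (abs_nonneg _) (by linarith [hpos t ht.1])
    _ ≤ 2 * t ^ (r + 1) := by linarith [hug t ht.1]

end Paper
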